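/- arXiv:1802.07396 — 2 statements merged into one kernel-verified Lean document; each statement's English description precedes it below -/
import Mathlib

section
/- Let p be a prime and let k be an algebraically closed field of characteristic p, with φ the Frobenius automorphism of the Witt vectors W(k). Then every nonzero element c of W(k) can be written as c = p^r · u⁻¹ · φ(u) for some natural number r and some unit u of W(k); moreover r is uniquely determined by c (it equals the p-adic valuation of c in the discrete valuation ring W(k)). -/
namespace WittVector

variable {p : ℕ} [Fact p.Prime] {k : Type*} [Field k] [CharP k p]

/-- Lang's theorem for the unit group of the Witt vectors of an algebraically closed field. -/
theorem exists_eq_inv_mul_frobenius [IsAlgClosed k] {b : WittVector p k} (hb : b.coeff 0 ≠ 0) :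
    ∃ u : (WittVector p k)ˣ,
      b = ((u⁻¹ : (WittVector p k)ˣ) : WittVector p k) * frobenius (u : WittVector p k) := by
  have h_one : (1 : WittVector p k).coeff 0 ≠ 0 := by simp
  have h_unit : IsUnit (frobeniusRotation p h_one hb) :=
    isUnit_of_coeff_zero_ne_zero _ <| by
      simpa only [frobeniusRotation, coeff_mk, frobeniusRotationCoeff] using
        RecursionBase.solution_nonzero p h_one hb
  obtain ⟨u, hu⟩ := h_unit
  have h_frob := frobenius_frobeniusRotation p h_one hb
  rw [mul_one, ← hu] at h_frob
  exact ⟨u, by rw [h_frob, Units.inv_mul_cancel_left]⟩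

/-- The exponent of `p` in a factorization `p ^ r * v` with `v` a unit is unique. -/
theorem pow_p_mul_unit_exponent_unique [PerfectRing k p] {r s : ℕ} (v w : (WittVector p k)ˣ)
    (h : (p : WittVector p k) ^ r * v = (p : WittVector p k) ^ s * w) : r = s :=
  IsDiscreteValuationRing.unit_mul_pow_congr_pow (irreducible p) (irreducible p) v w r s
    (by rw [mul_comm, h, mul_comm])

end WittVector


/-- Every nonzero element `c` of the Witt vectors `W(k)` of an algebraically closed field `k`
of characteristic `p` can be written as `c = p^r * u⁻¹ * φ(u)` for a natural number `r` and a
unit `u` of `W(k)`, where `φ` is the Frobenius automorphism; moreover `r` is uniquely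
determined by `c`. -/
theorem witt_frobenius_normal_form
    (p : ℕ) [Fact p.Prime] (k : Type*) [Field k] [CharP k p] [IsAlgClosed k]
    (c : WittVector p k) (hc : c ≠ 0) :
    ∃! r : ℕ, ∃ u : (WittVector p k)ˣ,
      c = (p : WittVector p k) ^ r *
            (((u⁻¹ : (WittVector p k)ˣ) : WittVector p k) *
              WittVector.frobenius ((u : (WittVector p k)ˣ) : WittVector p k)) := by
  obtain ⟨r, b, hb, rfl⟩ := WittVector.exists_eq_pow_p_mul c hc
  obtain ⟨u, rfl⟩ := WittVector.exists_eq_inv_mul_frobenius hb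
  refine ⟨r, ⟨u, rfl⟩, ?_⟩
  rintro s ⟨v, hv⟩
  refine (WittVector.pow_p_mul_unit_exponent_unique
    (u⁻¹ * Units.map (WittVector.frobenius : WittVector p k →+* WittVector p k) u)
    (v⁻¹ * Units.map (WittVector.frobenius : WittVector p k →+* WittVector p k) v) ?_).symm
  simpa only [Units.val_mul, Units.coe_map, MonoidHom.coe_coe] using hv
end

section
/- Let p be a prime, k an algebraically closed field of characteristic p, W = W(k) its ring of Witt vectors, and φ the Frobenius automorphism of W. Let M be a free W-module of rank 1 and let F : M → M be an additive map that is φ-semilinear (F(a • m) = φ(a) • F(m) for all a ∈ W, m ∈ M) and nonzero. Then there exist a W-basis element e of M and a natural number r such that F(e) = p^r • e; moreover r is uniquely determined by (M, F). In other words, every rank-one F-crystal over k is isomorphic to (W, x ↦ p^r φ(x)) for a unique r ≥ 0. -/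
open WittVector in
/-- Over an algebraically closed field, a Witt vector unit `u` admits a unit `b` with
`φ(b) * u = b`. -/
theorem WittVector.exists_unit_frobenius_mul_eq (p : ℕ) [Fact p.Prime] {k : Type*} [Field k]
    [CharP k p] [IsAlgClosed k] {u : WittVector p k} (hu : u.coeff 0 ≠ 0) :
    ∃ b : WittVector p k, IsUnit b ∧ frobenius b * u = b := by
  have h1 : (1 : WittVector p k).coeff 0 ≠ 0 := by simp
  refine ⟨frobeniusRotation p hu h1, isUnit_of_coeff_zero_ne_zero _ ?_, ?_⟩
  · rw [frobeniusRotation, coeff_mk, frobeniusRotationCoeff]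
    exact RecursionBase.solution_nonzero p hu h1
  · simpa using frobenius_frobeniusRotation p hu h1

/-- The matrix coefficients of a semilinear endomorphism with respect to two generators of a
torsion-free cyclic module are associated. -/
theorem LinearMap.associated_of_span_singleton_eq_top {R M : Type*} [CommRing R] [IsDomain R]
    [AddCommGroup M] [Module R M] [Module.IsTorsionFree R M] [Nontrivial M] {σ : R →+* R}
    (F : M →ₛₗ[σ] M) {x y : M} (hx : Submodule.span R {x} = ⊤) (hy : Submodule.span R {y} = ⊤)
    {a b : R} (ha : F x = a • x) (hb : F y = b • y) : Associated a b := by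
  obtain ⟨c, rfl⟩ := Submodule.mem_span_singleton.1
    (hx ▸ Submodule.mem_top : y ∈ Submodule.span R {x})
  obtain ⟨d, hd⟩ := Submodule.mem_span_singleton.1
    (hy ▸ Submodule.mem_top : x ∈ Submodule.span R {c • x})
  have hx0 : x ≠ 0 := by
    rintro rfl
    simp at hx
  have hdc : d * c = 1 := smul_left_injective R hx0 (by simpa [mul_smul] using hd)
  have hc : IsUnit c := .of_mul_eq_one_right d hdc
  have key : σ c * a = b * c :=
    smul_left_injective R hx0 (by simpa [mul_smul, ha] using hb)
  have h₁ : Associated (σ c * a) a := associated_unit_mul_left a _ (hc.map σ)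
  have h₂ : Associated (b * c) b := associated_mul_unit_left b c hc
  exact h₁.symm.trans (key ▸ h₂)

/-- Dieudonné–Manin classification, rank-one case: a free `W(k)`-module `M` of rank `1`
with a nonzero Frobenius-semilinear endomorphism `F` admits a basis element `e` with
`F e = p^r • e`, and the natural number `r` is uniquely determined by `(M, F)`. -/
theorem rank_one_F_crystal_classification
    (p : ℕ) [Fact p.Prime] (k : Type*) [Field k] [CharP k p] [IsAlgClosed k]
    (M : Type*) [AddCommGroup M] [Module (WittVector p k) M]
    [Module.Free (WittVector p k) M] [Module.Finite (WittVector p k) M]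
    (hrank : Module.finrank (WittVector p k) M = 1)
    (F : M →ₛₗ[(WittVector.frobenius : WittVector p k →+* WittVector p k)] M)
    (hF : F ≠ 0) :
    ∃! r : ℕ, ∃ e : M, Submodule.span (WittVector p k) {e} = ⊤ ∧
      F e = ((p : WittVector p k) ^ r) • e := by
  have : Nontrivial M := Module.nontrivial_of_finrank_eq_succ hrank
  let B := Module.basisUnique (R := WittVector p k) Unit hrank
  set x := B default
  have hx : Submodule.span (WittVector p k) {x} = ⊤ := by
    rw [← B.span_eq, Set.range_unique]
  obtain ⟨a, ha⟩ := Submodule.mem_span_singleton.1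
    (hx ▸ Submodule.mem_top : F x ∈ Submodule.span (WittVector p k) {x})
  have ha0 : a ≠ 0 := by
    rintro rfl
    refine hF (B.ext fun i => ?_)
    rw [Subsingleton.elim i default, LinearMap.zero_apply]
    simpa using ha.symm
  obtain ⟨r, u, hu, rfl⟩ := WittVector.exists_eq_pow_p_mul a ha0
  obtain ⟨b, hb, hbu⟩ := WittVector.exists_unit_frobenius_mul_eq p hu
  have he : Submodule.span (WittVector p k) {b • x} = ⊤ := by
    rw [Submodule.span_singleton_smul_eq hb, hx]
  have hFe : F (b • x) = (p : WittVector p k) ^ r • b • x := by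
    rw [map_smulₛₗ, ← ha, ← mul_smul, ← mul_smul]
    congr 1
    linear_combination (p : WittVector p k) ^ r * hbu
  refine ⟨r, ⟨b • x, he, hFe⟩, ?_⟩
  rintro s ⟨y, hy, hFy⟩
  have h := F.associated_of_span_singleton_eq_top hy he hFy hFe
  have hp := WittVector.irreducible (k := k) p
  exact le_antisymm ((pow_dvd_pow_iff hp.ne_zero hp.not_isUnit).1 h.dvd)
    ((pow_dvd_pow_iff hp.ne_zero hp.not_isUnit).1 h.symm.dvd)
end
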